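/- arXiv:2102.09463 — 6 statements merged into one kernel-verified Lean document; each statement's English description precedes it below -/
import Mathlib

section
/- Let A : ℕ → ℤ and let j : ℕ. The stack obtained by folding the step function step S v = v :: S.dropWhile (fun x => v ≤ x) over the values A 0, A 1, …, A j, starting from the empty stack, is exactly the deduplication (keeping first occurrences) of the list [RMQ A j j, RMQ A (j−1) j, …, RMQ A 0 j]; that is, List.foldl step [] ((List.range (j+1)).map A) = (((List.range (j+1)).map (fun i => RMQ A i j)).reverse).dedup. -/
/-- Range minimum query: the minimum of `A k` over `k ∈ Finset.Icc i j`. -/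
def RMQ (A : ℕ → ℤ) (i j : ℕ) : ℤ :=
  if h : i ≤ j then (Finset.Icc i j).inf' (by simpa using h) A else A i

/-- The Cartesian-tree stack step: pop every element `≥ v` from the top, then push `v`.
The head of the list is the top of the stack. -/
def step (S : List ℤ) (v : ℤ) : List ℤ := v :: S.dropWhile (fun x => v ≤ x)

theorem RMQ_self (A : ℕ → ℤ) (j : ℕ) : RMQ A j j = A j := by
  simp [RMQ]

theorem RMQ_succ_right (A : ℕ → ℤ) {i j : ℕ} (h : i ≤ j) :
    RMQ A i (j + 1) = min (RMQ A i j) (A (j + 1)) := by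
  refine eq_of_forall_le_iff fun c => ?_
  simp only [RMQ, h, Nat.le_succ_of_le h, dite_true, Finset.le_inf'_iff, Finset.mem_Icc, le_min_iff]
  refine ⟨fun H => ⟨fun k hk => H k ⟨hk.1, by omega⟩, H _ ⟨by omega, le_rfl⟩⟩, ?_⟩
  rintro ⟨H, hv⟩ k ⟨hik, hkj⟩
  obtain rfl | hk := Nat.eq_or_lt_of_le hkj
  · exact hv
  · exact H k ⟨hik, by omega⟩

theorem reverse_map_RMQ_succ (A : ℕ → ℤ) (j : ℕ) :
    ((List.range (j + 2)).map (fun i => RMQ A i (j + 1))).reverse =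
      A (j + 1) ::
        (((List.range (j + 1)).map (fun i => RMQ A i j)).reverse).map (min · (A (j + 1))) := by
  rw [List.range_succ, List.map_append, List.reverse_append]
  simp only [List.map_cons, List.map_nil, List.reverse_singleton, RMQ_self, List.singleton_append,
    List.cons.injEq, true_and, ← List.map_reverse, List.map_map]
  refine List.map_congr_left fun i hi => RMQ_succ_right A ?_
  simp only [List.mem_reverse, List.mem_range] at hi
  omega

theorem pairwise_ge_reverse_map_RMQ (A : ℕ → ℤ) (j : ℕ) :
    (((List.range (j + 1)).map (fun i => RMQ A i j)).reverse).Pairwise (· ≥ ·) := by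
  induction j with
  | zero => simp
  | succ j ih =>
    rw [reverse_map_RMQ_succ, List.pairwise_cons]
    exact ⟨by simp, ih.map _ fun _ _ h => min_le_min_right _ h⟩

/-- On a non-increasing list, stepping the deduplicated stack by `v` amounts to capping every
entry at `v` and pushing `v`. -/
theorem step_dedup_of_pairwise_ge {L : List ℤ} (hL : L.Pairwise (· ≥ ·)) (v : ℤ) :
    step L.dedup v = (v :: L.map (min · v)).dedup := by
  induction L with
  | nil => simp [step]
  | cons a L ih =>
    obtain ⟨ha, hL'⟩ := List.pairwise_cons.1 hL
    by_cases hv : v ≤ a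
    · have hdrop : step (a :: L).dedup v = step L.dedup v := by
        by_cases hm : a ∈ L
        · rw [List.dedup_cons_of_mem hm]
        · rw [List.dedup_cons_of_notMem hm, step, step,
            List.dropWhile_cons_of_pos (by simpa using hv)]
      rw [hdrop, ih hL', List.map_cons, min_eq_right hv,
        List.dedup_cons_of_mem (List.mem_cons_self (a := v))]
    · have hlt : ∀ x ∈ a :: L, x < v := by
        intro x hx
        rcases List.mem_cons.1 hx with rfl | hx
        · exact not_le.1 hv
        · exact (ha x hx).trans_lt (not_le.1 hv)
      have hmap : (a :: L).map (min · v) = a :: L :=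
        (List.map_congr_left fun x hx => min_eq_left (hlt x hx).le).trans (List.map_id _)
      rw [hmap, List.dedup_cons_of_notMem fun h => (hlt v h).false, step]
      congr 1
      rw [List.dropWhile_eq_self_iff]
      intro h
      simpa using hlt _ (List.mem_dedup.1 (List.getElem_mem h))

theorem stack_eq_dedup_of_RMQ (A : ℕ → ℤ) (j : ℕ) :
    List.foldl step [] ((List.range (j + 1)).map A) =
      (((List.range (j + 1)).map (fun i => RMQ A i j)).reverse).dedup := by
  induction j with
  | zero => simp [step, RMQ_self]
  | succ j ih =>
    rw [List.range_succ, List.map_append, List.foldl_append, ih, ← List.range_succ,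
      reverse_map_RMQ_succ, ← step_dedup_of_pairwise_ge (pairwise_ge_reverse_map_RMQ A j)]
    rfl
end

section
/- Let A : ℕ → ℤ and let j : ℕ. An integer v is an element of the stack List.foldl step [] ((List.range (j+1)).map A) if and only if there exists k ≤ j with A k = v and A k < A k' for every k' with k < k' ≤ j (i.e. k is a strict suffix-minimum position of A up to j). -/
theorem mem_dropWhile_le_iff_of_pairwise_gt {α : Type*} [LinearOrder α] {S : List α}
    (hS : S.Pairwise (· > ·)) (v x : α) :
    x ∈ S.dropWhile (fun y => v ≤ y) ↔ x ∈ S ∧ x < v := by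
  induction S with
  | nil => simp
  | cons a S ih =>
    rw [List.pairwise_cons] at hS
    by_cases h : v ≤ a
    · rw [List.dropWhile_cons_of_pos (by simpa using h), ih hS.2, List.mem_cons]
      grind
    · rw [List.dropWhile_cons_of_neg (by simpa using h), List.mem_cons]
      grind

theorem mem_step_iff {S : List ℤ} (hS : S.Pairwise (· > ·)) (v x : ℤ) :
    x ∈ step S v ↔ x = v ∨ x ∈ S ∧ x < v := by
  rw [step, List.mem_cons, mem_dropWhile_le_iff_of_pairwise_gt hS]

theorem pairwise_gt_step {S : List ℤ} (hS : S.Pairwise (· > ·)) (v : ℤ) :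
    (step S v).Pairwise (· > ·) :=
  List.pairwise_cons.2
    ⟨fun x hx => ((mem_dropWhile_le_iff_of_pairwise_gt hS v x).1 hx).2,
      hS.sublist (List.dropWhile_sublist _)⟩

theorem pairwise_gt_foldl_step {S : List ℤ} (hS : S.Pairwise (· > ·)) (l : List ℤ) :
    (l.foldl step S).Pairwise (· > ·) := by
  induction l generalizing S with
  | nil => exact hS
  | cons v l ih => exact ih (pairwise_gt_step hS v)

theorem mem_foldl_step_range_iff (A : ℕ → ℤ) (n : ℕ) (v : ℤ) :
    v ∈ List.foldl step [] ((List.range n).map A) ↔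
      ∃ k, k < n ∧ A k = v ∧ ∀ k', k < k' → k' < n → A k < A k' := by
  induction n with
  | zero => simp
  | succ n ih =>
    rw [List.range_succ, List.map_append, List.foldl_append, List.map_singleton,
      List.foldl_cons, List.foldl_nil,
      mem_step_iff (pairwise_gt_foldl_step List.Pairwise.nil _), ih]
    constructor
    · rintro (rfl | ⟨⟨k, hk, rfl, hmin⟩, hlt⟩)
      · exact ⟨n, n.lt_succ_self, rfl, fun k' h h' => by lia⟩
      · refine ⟨k, by lia, rfl, fun k' h h' => ?_⟩
        rcases Nat.lt_succ_iff_lt_or_eq.1 h' with h' | rfl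
        exacts [hmin k' h h', hlt]
    · rintro ⟨k, hk, rfl, hmin⟩
      rcases Nat.lt_succ_iff_lt_or_eq.1 hk with hk | rfl
      · exact .inr ⟨⟨k, hk, rfl, fun k' h h' => hmin k' h (by lia)⟩, hmin n hk n.lt_succ_self⟩
      · exact .inl rfl

theorem mem_stack_iff_strict_suffix_min (A : ℕ → ℤ) (j : ℕ) (v : ℤ) :
    v ∈ List.foldl step [] ((List.range (j + 1)).map A) ↔
      ∃ k, k ≤ j ∧ A k = v ∧ ∀ k', k < k' → k' ≤ j → A k < A k' := by
  simpa only [Nat.lt_succ_iff] using mem_foldl_step_range_iff A (j + 1) v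
end

section
/- Let A : ℕ → ℤ, let j : ℕ and let i ≤ j. The set K = { k : i ≤ k ≤ j and A k < A k' for every k' with k < k' ≤ j } is nonempty, and RMQ A i j = A (min K), where min K is the least element of K. That is, a range-minimum query is answered by locating the least strict suffix-minimum position that is ≥ i (the successor of i among the set representatives) and returning its value. -/
/-- Every position `k ≤ j` is dominated by a strict suffix-minimum position in `[k, j]`. -/
theorem exists_strict_suffix_min_le {α : Type*} [LinearOrder α] (A : ℕ → α) {j k : ℕ}
    (hkj : k ≤ j) :
    ∃ m, k ≤ m ∧ m ≤ j ∧ (∀ k', m < k' → k' ≤ j → A m < A k') ∧ A m ≤ A k := by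
  by_cases h : ∀ k', k < k' → k' ≤ j → A k < A k'
  · exact ⟨k, le_rfl, hkj, h, le_rfl⟩
  · push Not at h
    obtain ⟨l, hkl, hlj, hl⟩ := h
    obtain ⟨m, hlm, hmj, hm, hml⟩ := exists_strict_suffix_min_le A hlj
    exact ⟨m, hkl.le.trans hlm, hmj, hm, hml.trans hl⟩
termination_by j - k

theorem RMQ_eq_val_at_least_suffix_min (A : ℕ → ℤ) (j i : ℕ) (hij : i ≤ j) :
    ({k : ℕ | i ≤ k ∧ k ≤ j ∧ ∀ k', k < k' → k' ≤ j → A k < A k'}).Nonempty ∧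
      RMQ A i j = A (sInf {k : ℕ | i ≤ k ∧ k ≤ j ∧ ∀ k', k < k' → k' ≤ j → A k < A k'}) := by
  have hne : {k : ℕ | i ≤ k ∧ k ≤ j ∧ ∀ k', k < k' → k' ≤ j → A k < A k'}.Nonempty :=
    ⟨j, hij, le_rfl, fun _ h h' => absurd h h'.not_gt⟩
  refine ⟨hne, ?_⟩
  obtain ⟨him, hmj, hm⟩ := Nat.sInf_mem hne
  rw [RMQ, dif_pos hij]
  refine le_antisymm (Finset.inf'_le A (Finset.mem_Icc.2 ⟨him, hmj⟩))
    (Finset.le_inf' _ _ fun k hk => ?_)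
  obtain ⟨hik, hkj⟩ := Finset.mem_Icc.1 hk
  obtain ⟨l, hkl, hlj, hl, hlk⟩ := exists_strict_suffix_min_le A hkj
  rcases (Nat.sInf_le (s := {k | i ≤ k ∧ k ≤ j ∧ ∀ k', k < k' → k' ≤ j → A k < A k'})
    ⟨hik.trans hkl, hlj, hl⟩).eq_or_lt with h | h
  · exact (congrArg A h).trans_le hlk
  · exact (hm l h hlj).le.trans hlk
end

section
/- Let A : ℕ → ℤ and let j : ℕ. The map k ↦ A k is a strictly monotone bijection from the set { k ≤ j : A k < A k' for every k' with k < k' ≤ j } of strict suffix-minimum positions of A up to j onto the set { RMQ A i j : i ≤ j } of distinct answers to range-minimum queries ending at j. In particular these two sets have the same cardinality. -/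
theorem RMQ_le (A : ℕ → ℤ) {i j k : ℕ} (hik : i ≤ k) (hkj : k ≤ j) : RMQ A i j ≤ A k := by
  rw [RMQ, dif_pos (hik.trans hkj)]
  exact Finset.inf'_le _ (Finset.mem_Icc.2 ⟨hik, hkj⟩)

theorem exists_RMQ_eq (A : ℕ → ℤ) {i j : ℕ} (h : i ≤ j) :
    ∃ k, i ≤ k ∧ k ≤ j ∧ RMQ A i j = A k := by
  obtain ⟨k, hk, hA⟩ := Finset.exists_mem_eq_inf' (Finset.nonempty_Icc.2 h) A
  rw [Finset.mem_Icc] at hk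
  exact ⟨k, hk.1, hk.2, by rw [RMQ, dif_pos h, hA]⟩

/-- A range minimum ending at `j` is attained at a strict suffix-minimum position, namely the
last position attaining it. -/
theorem exists_suffix_min_eq_RMQ (A : ℕ → ℤ) {i j : ℕ} (h : i ≤ j) :
    ∃ k ≤ j, (∀ k', k < k' → k' ≤ j → A k < A k') ∧ A k = RMQ A i j := by
  classical
  obtain ⟨m, him, hmj, hm⟩ := exists_RMQ_eq A h
  let P : ℕ → Prop := fun k => i ≤ k ∧ A k = RMQ A i j
  obtain ⟨hik, hAk⟩ : P (Nat.findGreatest P j) :=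
    Nat.findGreatest_spec hmj ⟨him, hm.symm⟩
  refine ⟨Nat.findGreatest P j, Nat.findGreatest_le j, fun k' hk hk'j => ?_, hAk⟩
  have hik' : i ≤ k' := hik.trans hk.le
  rw [hAk]
  exact lt_of_le_of_ne (RMQ_le A hik' hk'j) fun he =>
    Nat.findGreatest_is_greatest hk hk'j ⟨hik', he.symm⟩

theorem RMQ_eq_of_suffix_min (A : ℕ → ℤ) {j k : ℕ} (hkj : k ≤ j)
    (hk : ∀ k', k < k' → k' ≤ j → A k < A k') : RMQ A k j = A k := by
  obtain ⟨m, hkm, hmj, hm⟩ := exists_RMQ_eq A hkj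
  refine le_antisymm (RMQ_le A le_rfl hkj) ?_
  rw [hm]
  rcases hkm.eq_or_lt with rfl | hlt
  · exact le_rfl
  · exact (hk m hlt hmj).le

theorem suffix_min_bijOn_RMQ_answers (A : ℕ → ℤ) (j : ℕ) :
    Set.BijOn A
        {k : ℕ | k ≤ j ∧ ∀ k', k < k' → k' ≤ j → A k < A k'}
        {v : ℤ | ∃ i ≤ j, RMQ A i j = v} ∧
      StrictMonoOn A {k : ℕ | k ≤ j ∧ ∀ k', k < k' → k' ≤ j → A k < A k'} ∧
      Nat.card {k : ℕ | k ≤ j ∧ ∀ k', k < k' → k' ≤ j → A k < A k'} =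
        Nat.card {v : ℤ | ∃ i ≤ j, RMQ A i j = v} := by
  have hmono : StrictMonoOn A {k : ℕ | k ≤ j ∧ ∀ k', k < k' → k' ≤ j → A k < A k'} :=
    fun _ ha b hb hab => ha.2 b hab hb.1
  have hbij : Set.BijOn A {k : ℕ | k ≤ j ∧ ∀ k', k < k' → k' ≤ j → A k < A k'}
      {v : ℤ | ∃ i ≤ j, RMQ A i j = v} := by
    refine ⟨fun k hk => ⟨k, hk.1, RMQ_eq_of_suffix_min A hk.1 hk.2⟩, hmono.injOn, ?_⟩
    rintro _ ⟨i, hi, rfl⟩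
    obtain ⟨k, hkj, hk, hA⟩ := exists_suffix_min_eq_RMQ A hi
    exact ⟨k, ⟨hkj, hk⟩, hA⟩
  exact ⟨hbij, hmono, Nat.card_congr (hbij.equiv A)⟩
end

section
/- Let C ≥ 0 be a real number and let T : ℕ → ℝ satisfy T u ≥ 0 for all u, T u ≤ C for u ≤ 1, and T u ≤ 2^(u/2) + 2 * T (u/2) for all u ≥ 2 (where u/2 denotes natural-number division). Then there exists a constant C' such that T u ≤ C' * 2^(u/2) for all u ≥ 1; that is, the recursion T(u) = 2^{u/2} + 2 T(u/2) is bounded by O(2^{u/2}). -/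
/-- The recursion `T u ≤ 2^(u/2) + 2 * T (u/2)` (natural-number division) with a
bounded base case is bounded by `O(2^(u/2))`. -/
theorem veb_bulk_delete_recursion (C : ℝ) (hC : 0 ≤ C) (T : ℕ → ℝ)
    (hT0 : ∀ u, 0 ≤ T u)
    (hbase : ∀ u, u ≤ 1 → T u ≤ C)
    (hrec : ∀ u, 2 ≤ u → T u ≤ 2 ^ (u / 2) + 2 * T (u / 2)) :
    ∃ C' : ℝ, ∀ u, 1 ≤ u → T u ≤ C' * 2 ^ (u / 2) := by
  refine ⟨C + 2, fun u hu => ?_⟩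
  have h1 : T 1 ≤ C := hbase 1 le_rfl
  have h2 : T 2 ≤ 2 + 2 * T 1 := by simpa using hrec 2 le_rfl
  induction u using Nat.strong_induction_on with
  | _ u ih =>
    rcases Nat.lt_or_ge u 2 with hlt | hge
    · obtain rfl : u = 1 := by omega
      norm_num
      linarith
    have hr := hrec u hge
    have hm1 : 1 ≤ u / 2 := by omega
    have ihm := ih (u / 2) (by omega) hm1
    generalize u / 2 = m at hr ihm hm1 ⊢
    rcases Nat.lt_or_ge m 3 with hm | hm
    · interval_cases m
      · norm_num at hr ⊢
        linarith
      · norm_num at hr ⊢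
        linarith
    · have hpow : (2 : ℝ) ^ (m / 2 + 2) ≤ 2 ^ m :=
        pow_le_pow_right₀ one_le_two (by omega)
      rw [pow_add] at hpow
      have hpos : (0 : ℝ) < 2 ^ m := by positivity
      nlinarith [mul_le_mul_of_nonneg_left hpow (by linarith : 0 ≤ C + 2),
        mul_nonneg hC hpos.le]
end

section
/- Let A : ℕ → ℤ and let j : ℕ. The length of the stack List.foldl step [] ((List.range (j+1)).map A) equals the number of positions k ≤ j such that A k < A k' for every k' with k < k' ≤ j (the number of strict suffix-minimum positions of A up to j), and this stack has no duplicate elements. -/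
theorem dropWhile_le_eq_filter_lt {S : List ℤ} (hS : S.Pairwise (· > ·)) (v : ℤ) :
    S.dropWhile (fun x => v ≤ x) = S.filter (fun x => x < v) := by
  induction S with
  | nil => rfl
  | cons a S ih =>
    rw [List.pairwise_cons] at hS
    by_cases h : v ≤ a
    · rw [List.dropWhile_cons_of_pos (by simpa using h),
        List.filter_cons_of_neg (by simpa using h), ih hS.2]
    · rw [List.dropWhile_cons_of_neg (by simpa using h), eq_comm, List.filter_eq_self]
      intro x hx
      have : x ≤ a := by
        rcases List.mem_cons.1 hx with rfl | hx
        · exact le_rfl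
        · exact (hS.1 x hx).le
      simpa using this.trans_lt (not_le.1 h)

theorem mem_step {S : List ℤ} (hS : S.Pairwise (· > ·)) {v x : ℤ} :
    x ∈ step S v ↔ x = v ∨ x ∈ S ∧ x < v := by
  simp [step, dropWhile_le_eq_filter_lt hS]

theorem mem_foldl_step_range (A : ℕ → ℤ) (n : ℕ) (x : ℤ) :
    x ∈ ((List.range n).map A).foldl step [] ↔
      ∃ k < n, (∀ k', k < k' → k' < n → A k < A k') ∧ A k = x := by
  induction n with
  | zero => simp
  | succ n ih =>
    rw [List.range_succ, List.map_append, List.foldl_append, List.map_singleton,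
      List.foldl_cons, List.foldl_nil, mem_step (pairwise_gt_foldl_step .nil _), ih]
    constructor
    · rintro (rfl | ⟨⟨k, hk, hmin, rfl⟩, hx⟩)
      · exact ⟨n, by omega, fun k' _ _ => by omega, rfl⟩
      · refine ⟨k, by omega, fun k' h h' => ?_, rfl⟩
        rcases Nat.lt_succ_iff_lt_or_eq.1 h' with h' | rfl
        · exact hmin k' h h'
        · exact hx
    · rintro ⟨k, hk, hmin, rfl⟩
      rcases Nat.lt_succ_iff_lt_or_eq.1 hk with hk | rfl
      · exact .inr ⟨⟨k, hk, fun k' h h' => hmin k' h (by omega), rfl⟩, hmin n hk (by omega)⟩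
      · exact .inl rfl

theorem stack_length_and_nodup (A : ℕ → ℤ) (j : ℕ) :
    (List.foldl step [] ((List.range (j + 1)).map A)).length =
        Nat.card {k : ℕ | k ≤ j ∧ ∀ k', k < k' → k' ≤ j → A k < A k'} ∧
      (List.foldl step [] ((List.range (j + 1)).map A)).Nodup := by
  have hnodup : (List.foldl step [] ((List.range (j + 1)).map A)).Nodup :=
    (pairwise_gt_foldl_step .nil _).imp ne_of_gt
  refine ⟨?_, hnodup⟩
  have hinj : Set.InjOn A {k : ℕ | k ≤ j ∧ ∀ k', k < k' → k' ≤ j → A k < A k'} := by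
    rintro a ⟨ha, ha'⟩ b ⟨hb, hb'⟩ hab
    rcases lt_trichotomy a b with h | h | h
    · exact absurd hab (ha' b h hb).ne
    · exact h
    · exact absurd hab (hb' a h ha).ne'
  rw [Nat.card_coe_set_eq, ← hinj.ncard_image, ← List.toFinset_card_of_nodup hnodup,
    ← Set.ncard_coe_finset]
  congr 1
  ext x
  simp [mem_foldl_step_range, and_assoc]
end
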